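/- For all integers m ≥ 0 and r ≥ 1, ∑_{k=0}^r ( C(m,k−1)^2 C(m,r−k)^2 + C(m,k−2) C(m,k) C(m,r−k)^2 − 2 C(m,k−1) C(m,k) C(m,r−k−1) C(m,r−k) ) = ∑_{λ} N_λ(m), where λ ranges over all partitions of 2r−2 whose parts all lie in {1,2,3,4} and in which each of the parts 1, 2 and 3 occurs an even number of times, and N_λ(m) denotes the number of semistandard Young tableaux of shape λ with entries in {1,…,m}. -/

import Mathlib

/-- The binomial coefficient `C(m, j)` for an integer index `j`, with the convention
that it vanishes for `j < 0` (and for `j > m`, as usual). -/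
def Cz (m : ℕ) (j : ℤ) : ℤ := if 0 ≤ j then (Nat.choose m j.toNat : ℤ) else 0

/-- The cells of the Young diagram whose `i`-th row (0-indexed) has length `L i`,
where all rows have index `< N` and length `≤ M`. -/
def cellsOf (L : ℕ → ℕ) (N M : ℕ) : Finset (ℕ × ℕ) :=
  (Finset.range N ×ˢ Finset.range M).filter fun p => p.2 < L p.1

/-- A filling `T` of the cells of a shape with entries in `{1, …, m}`
(encoded as `Fin m`) is a semistandard Young tableau if it weakly increases
along each row and strictly increases down each column. -/
def IsSSYT (L : ℕ → ℕ) (N M m : ℕ) (T : {c // c ∈ cellsOf L N M} → Fin m) : Prop :=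
  (∀ c c' : {c // c ∈ cellsOf L N M},
      (c : ℕ × ℕ).1 = (c' : ℕ × ℕ).1 → (c : ℕ × ℕ).2 ≤ (c' : ℕ × ℕ).2 → T c ≤ T c') ∧
  (∀ c c' : {c // c ∈ cellsOf L N M},
      (c : ℕ × ℕ).2 = (c' : ℕ × ℕ).2 → (c : ℕ × ℕ).1 < (c' : ℕ × ℕ).1 → T c < T c')

instance (L : ℕ → ℕ) (N M m : ℕ) : DecidablePred (IsSSYT L N M m) := fun _ => by
  unfold IsSSYT; infer_instance

/-- `numSSYT m L N M` is the number of semistandard Young tableaux with entries in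
`{1, …, m}` of the shape with row lengths `L` (rows indexed by `i < N`,
row lengths at most `M`). -/
noncomputable def numSSYT (m : ℕ) (L : ℕ → ℕ) (N M : ℕ) : ℕ :=
  (Finset.univ.filter (IsSSYT L N M m)).card

/-- Row lengths of the partition `(4^{i4}, 3^{2 i3}, 2^{2 i2}, 1^{2 i1})`. -/
def rl (i4 i3 i2 i1 : ℕ) : ℕ → ℕ := fun i =>
  if i < i4 then 4
  else if i < i4 + 2 * i3 then 3
  else if i < i4 + 2 * i3 + 2 * i2 then 2
  else if i < i4 + 2 * i3 + 2 * i2 + 2 * i1 then 1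
  else 0

open Finset Polynomial

/-- The semistandardness condition for a filling of an arbitrary finite set `D` of cells. -/
def IsSemistandardOn (D : Finset (ℕ × ℕ)) (m : ℕ) (T : {x // x ∈ D} → Fin m) : Prop :=
  (∀ x y : {x // x ∈ D}, (x : ℕ × ℕ).1 = (y : ℕ × ℕ).1 →
      (x : ℕ × ℕ).2 ≤ (y : ℕ × ℕ).2 → T x ≤ T y) ∧
  (∀ x y : {x // x ∈ D}, (x : ℕ × ℕ).2 = (y : ℕ × ℕ).2 →
      (x : ℕ × ℕ).1 < (y : ℕ × ℕ).1 → T x < T y)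

open Classical in
/-- The number of semistandard fillings of `D` with entries in `Fin m`. -/
noncomputable def semistandardCount (m : ℕ) (D : Finset (ℕ × ℕ)) : ℕ :=
  #{T | IsSemistandardOn D m T}

lemma numSSYT_eq_semistandardCount (m : ℕ) (L : ℕ → ℕ) (N M : ℕ) :
    numSSYT m L N M = semistandardCount m (cellsOf L N M) := by
  unfold numSSYT semistandardCount
  congr 1
  ext T
  simp only [mem_filter]
  rfl

/-- The diagram whose `j`-th column has length `c j`. -/
def columnDiagram {n : ℕ} (c : Fin n → ℕ) : Finset (ℕ × ℕ) :=
  univ.biUnion fun j => (range (c j)).image fun i => (i, (j : ℕ))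

lemma mem_columnDiagram {n : ℕ} {c : Fin n → ℕ} {x : ℕ × ℕ} :
    x ∈ columnDiagram c ↔ ∃ j : Fin n, x.2 = j ∧ x.1 < c j := by
  obtain ⟨a, b⟩ := x
  simp only [columnDiagram, mem_biUnion, mem_univ, true_and, mem_image, mem_range, Prod.mk.injEq]
  constructor
  · rintro ⟨j, i, hi, rfl, rfl⟩
    exact ⟨j, rfl, hi⟩
  · rintro ⟨j, hj, h⟩
    exact ⟨j, a, h, rfl, hj.symm⟩

lemma mk_mem_columnDiagram {n : ℕ} {c : Fin n → ℕ} {i : ℕ} {j : Fin n} :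
    (i, (j : ℕ)) ∈ columnDiagram c ↔ i < c j := by
  rw [mem_columnDiagram]
  constructor
  · rintro ⟨k, hk, h⟩
    rwa [Fin.ext hk]
  · exact fun h => ⟨j, rfl, h⟩

open Classical in
/-- The columns of a filling that end with the largest available entry. -/
noncomputable def topColumns {n m : ℕ} (c : Fin n → ℕ)
    (T : {x // x ∈ columnDiagram c} → Fin (m + 1)) : Finset (Fin n) :=
  {j | ∃ h : (c j - 1, (j : ℕ)) ∈ columnDiagram c, T ⟨_, h⟩ = Fin.last m}

/-- Shorten by one the columns indexed by `s`. -/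
def shorten {n : ℕ} (c : Fin n → ℕ) (s : Finset (Fin n)) : Fin n → ℕ :=
  fun j => c j - if j ∈ s then 1 else 0

lemma columnDiagram_shorten_subset {n : ℕ} (c : Fin n → ℕ) (s : Finset (Fin n)) :
    columnDiagram (shorten c s) ⊆ columnDiagram c := by
  intro x hx
  obtain ⟨j, hj, h⟩ := mem_columnDiagram.1 hx
  exact mem_columnDiagram.2 ⟨j, hj, h.trans_le (Nat.sub_le _ _)⟩

lemma eq_of_notMem_columnDiagram_shorten {n : ℕ} {c : Fin n → ℕ} {s : Finset (Fin n)} {i : ℕ}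
    {j : Fin n} (h : i < c j) (h' : (i, (j : ℕ)) ∉ columnDiagram (shorten c s)) :
    j ∈ s ∧ i = c j - 1 := by
  rw [mk_mem_columnDiagram, shorten] at h'
  split_ifs at h' with hj
  · exact ⟨hj, by omega⟩
  · omega

open Classical in
/-- Fill the cells removed by `shorten` with the largest entry. -/
noncomputable def extendFilling {n m : ℕ} (c : Fin n → ℕ) (s : Finset (Fin n))
    (T : {x // x ∈ columnDiagram (shorten c s)} → Fin m) :
    {x // x ∈ columnDiagram c} → Fin (m + 1) :=
  fun x => if h : (x : ℕ × ℕ) ∈ columnDiagram (shorten c s) then (T ⟨x, h⟩).castSucc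
    else Fin.last m

lemma isSemistandardOn_extendFilling {n m : ℕ} {c : Fin n → ℕ} {s : Finset (Fin n)}
    (hs : Antitone (shorten c s)) {T : {x // x ∈ columnDiagram (shorten c s)} → Fin m}
    (hT : IsSemistandardOn _ m T) :
    IsSemistandardOn _ (m + 1) (extendFilling c s T) := by
  constructor
  · rintro ⟨⟨i, j'⟩, hx⟩ ⟨⟨i', k'⟩, hy⟩ h1 h2
    obtain ⟨j, rfl, hj⟩ := mem_columnDiagram.1 hx
    obtain ⟨k, rfl, hk⟩ := mem_columnDiagram.1 hy
    dsimp only at h1 h2 hj hk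
    subst h1
    simp only [extendFilling]
    by_cases hy' : (i, (k : ℕ)) ∈ columnDiagram (shorten c s)
    · have hx' : (i, (j : ℕ)) ∈ columnDiagram (shorten c s) :=
        mk_mem_columnDiagram.2 ((mk_mem_columnDiagram.1 hy').trans_le (hs h2))
      rw [dif_pos hx', dif_pos hy']
      exact Fin.castSucc_le_castSucc_iff.2 (hT.1 ⟨_, hx'⟩ ⟨_, hy'⟩ rfl h2)
    · rw [dif_neg hy']
      exact Fin.le_last _
  · rintro ⟨⟨i, j'⟩, hx⟩ ⟨⟨i', k'⟩, hy⟩ h1 h2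
    obtain ⟨j, rfl, hj⟩ := mem_columnDiagram.1 hx
    dsimp only at h1 h2 hj
    subst h1
    simp only [extendFilling]
    have hi' := mk_mem_columnDiagram.1 hy
    by_cases hx' : (i, (j : ℕ)) ∈ columnDiagram (shorten c s)
    · rw [dif_pos hx']
      by_cases hy' : (i', (j : ℕ)) ∈ columnDiagram (shorten c s)
      · rw [dif_pos hy']
        exact Fin.castSucc_lt_castSucc_iff.2 (hT.2 ⟨_, hx'⟩ ⟨_, hy'⟩ rfl h2)
      · rw [dif_neg hy']
        exact Fin.castSucc_lt_last _
    · have := eq_of_notMem_columnDiagram_shorten hj hx'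
      omega

lemma topColumns_extendFilling {n m : ℕ} {c : Fin n → ℕ} {s : Finset (Fin n)}
    (hpos : ∀ j ∈ s, 0 < c j) (T : {x // x ∈ columnDiagram (shorten c s)} → Fin m) :
    topColumns c (extendFilling c s T) = s := by
  ext j
  simp only [topColumns, mem_filter, mem_univ, true_and, extendFilling]
  constructor
  · rintro ⟨h, hj⟩
    by_cases h' : (c j - 1, (j : ℕ)) ∈ columnDiagram (shorten c s)
    · rw [dif_pos h'] at hj
      exact absurd hj (Fin.castSucc_lt_last _).ne
    · exact (eq_of_notMem_columnDiagram_shorten (mk_mem_columnDiagram.1 h) h').1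
  · intro hj
    have := hpos j hj
    refine ⟨mk_mem_columnDiagram.2 (by omega), ?_⟩
    rw [dif_neg]
    rw [mk_mem_columnDiagram, shorten, if_pos hj]
    omega

lemma lt_last_of_mem_shorten_topColumns {n m : ℕ} {c : Fin n → ℕ}
    {T : {x // x ∈ columnDiagram c} → Fin (m + 1)} (hT : IsSemistandardOn _ (m + 1) T)
    (x : {x // x ∈ columnDiagram c})
    (hx : (x : ℕ × ℕ) ∈ columnDiagram (shorten c (topColumns c T))) : T x < Fin.last m := by
  obtain ⟨⟨i, j'⟩, hx0⟩ := x
  obtain ⟨j, rfl, hj⟩ := mem_columnDiagram.1 hx0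
  dsimp only at hj hx
  rw [mk_mem_columnDiagram, shorten] at hx
  have hmem : (c j - 1, (j : ℕ)) ∈ columnDiagram c := mk_mem_columnDiagram.2 (by omega)
  rcases (show i ≤ c j - 1 by omega).lt_or_eq with hlt | rfl
  · exact (hT.2 ⟨_, hx0⟩ ⟨_, hmem⟩ rfl hlt).trans_le (Fin.le_last _)
  · refine lt_of_le_of_ne (Fin.le_last _) fun h => ?_
    have hjs : j ∈ topColumns c T := by
      simp only [topColumns, mem_filter, mem_univ, true_and]
      exact ⟨hx0, h⟩
    rw [if_pos hjs] at hx
    omega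

lemma exists_extendFilling_eq {n m : ℕ} {c : Fin n → ℕ}
    {T : {x // x ∈ columnDiagram c} → Fin (m + 1)} (hT : IsSemistandardOn _ (m + 1) T) :
    ∃ T', IsSemistandardOn _ m T' ∧ extendFilling c (topColumns c T) T' = T := by
  have hlt := lt_last_of_mem_shorten_topColumns hT
  have hsub := columnDiagram_shorten_subset c (topColumns c T)
  refine ⟨fun x => (T ⟨x, hsub x.2⟩).castLT (hlt ⟨x, hsub x.2⟩ x.2), ⟨?_, ?_⟩, ?_⟩
  · exact fun x y h1 h2 => hT.1 ⟨x, hsub x.2⟩ ⟨y, hsub y.2⟩ h1 h2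
  · exact fun x y h1 h2 => hT.2 ⟨x, hsub x.2⟩ ⟨y, hsub y.2⟩ h1 h2
  · funext x
    by_cases hx : (x : ℕ × ℕ) ∈ columnDiagram (shorten c (topColumns c T))
    · simp [extendFilling, hx]
    · rw [extendFilling, dif_neg hx]
      obtain ⟨⟨i, j'⟩, hx0⟩ := x
      obtain ⟨j, rfl, hj⟩ := mem_columnDiagram.1 hx0
      obtain ⟨hjs, rfl⟩ := eq_of_notMem_columnDiagram_shorten hj hx
      simp only [topColumns, mem_filter, mem_univ, true_and] at hjs
      exact hjs.2.symm

lemma extendFilling_injective {n m : ℕ} (c : Fin n → ℕ) (s : Finset (Fin n)) :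
    Function.Injective (extendFilling (m := m) c s) := by
  intro T T' h
  funext x
  have := congrFun h ⟨x, columnDiagram_shorten_subset c s x.2⟩
  simpa [extendFilling] using this

open Classical in
lemma card_filter_topColumns_eq {n m : ℕ} {c : Fin n → ℕ} {s : Finset (Fin n)}
    (hpos : ∀ j ∈ s, 0 < c j) (hs : Antitone (shorten c s)) :
    #{T | IsSemistandardOn (columnDiagram c) (m + 1) T ∧ topColumns c T = s} =
      semistandardCount m (columnDiagram (shorten c s)) := by
  symm
  refine card_bij (fun T _ => extendFilling c s T) ?_ ?_ ?_
  · intro T hT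
    simp only [mem_filter, mem_univ, true_and] at hT ⊢
    exact ⟨isSemistandardOn_extendFilling hs hT, topColumns_extendFilling hpos T⟩
  · exact fun T _ T' _ h => extendFilling_injective c s h
  · intro T hT
    simp only [mem_filter, mem_univ, true_and] at hT
    obtain ⟨hT, rfl⟩ := hT
    obtain ⟨T', hT', h⟩ := exists_extendFilling_eq hT
    exact ⟨T', by simpa using hT', h⟩

lemma pos_of_mem_topColumns {n m : ℕ} {c : Fin n → ℕ}
    {T : {x // x ∈ columnDiagram c} → Fin (m + 1)} {j : Fin n} (hj : j ∈ topColumns c T) :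
    0 < c j := by
  simp only [topColumns, mem_filter, mem_univ, true_and] at hj
  have := mk_mem_columnDiagram.1 hj.1
  omega

lemma antitone_shorten_topColumns {n m : ℕ} {c : Fin n → ℕ} (hc : Antitone c)
    {T : {x // x ∈ columnDiagram c} → Fin (m + 1)} (hT : IsSemistandardOn _ (m + 1) T) :
    Antitone (shorten c (topColumns c T)) := by
  intro j k hjk
  by_contra! hlt
  have hle := hc hjk
  have hk : (c k - 1, (k : ℕ)) ∈ columnDiagram (shorten c (topColumns c T)) := by
    rw [mk_mem_columnDiagram]
    simp only [shorten] at hlt ⊢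
    split_ifs at hlt ⊢ <;> omega
  have hj : j ∈ topColumns c T ∧ c j = c k := by
    simp only [shorten] at hlt
    split_ifs at hlt with h1 h2 h2
    · omega
    · exact ⟨h1, by omega⟩
    · omega
    · omega
  have hlast := lt_last_of_mem_shorten_topColumns hT
    ⟨_, columnDiagram_shorten_subset _ _ hk⟩ hk
  obtain ⟨hj, hcj⟩ := hj
  simp only [topColumns, mem_filter, mem_univ, true_and] at hj
  obtain ⟨hmem, hj⟩ := hj
  have := hT.1 ⟨_, hmem⟩ ⟨_, columnDiagram_shorten_subset _ _ hk⟩ (by simp [hcj]) hjk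
  rw [hj] at this
  exact absurd hlast (not_lt.2 this)

open Classical in
/-- The branching rule: remove the cells holding the largest entry. -/
lemma semistandardCount_succ {n m : ℕ} {c : Fin n → ℕ} (hc : Antitone c) :
    semistandardCount (m + 1) (columnDiagram c) =
      ∑ s : Finset (Fin n), if (∀ j ∈ s, 0 < c j) ∧ Antitone (shorten c s) then
        semistandardCount m (columnDiagram (shorten c s)) else 0 := by
  rw [semistandardCount, card_eq_sum_card_fiberwise (f := topColumns c) (t := univ)
    fun _ _ => mem_coe.2 (mem_univ _)]
  refine sum_congr rfl fun s _ => ?_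
  rw [filter_filter]
  split_ifs with h
  · exact card_filter_topColumns_eq h.1 h.2
  · rw [card_eq_zero, filter_eq_empty_iff]
    rintro T - ⟨hT, rfl⟩
    exact h ⟨fun j => pos_of_mem_topColumns, antitone_shorten_topColumns hc hT⟩

lemma Cz_neg (m : ℕ) {x : ℤ} (h : x < 0) : Cz m x = 0 := by simp [Cz, h]

lemma Cz_natCast (m k : ℕ) : Cz m k = m.choose k := by simp [Cz]

lemma Cz_succ (m : ℕ) (x : ℤ) : Cz (m + 1) x = Cz m x + Cz m (x - 1) := by
  rcases lt_trichotomy x 0 with h | rfl | h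
  · rw [Cz_neg _ h, Cz_neg _ h, Cz_neg _ (by omega), add_zero]
  · simp [Cz]
  · obtain ⟨k, rfl⟩ : ∃ k : ℕ, x = (k + 1 : ℕ) := ⟨(x - 1).toNat, by omega⟩
    rw [show ((k + 1 : ℕ) : ℤ) - 1 = k by push_cast; ring, Cz_natCast, Cz_natCast, Cz_natCast,
      Nat.choose_succ_succ]
    push_cast
    ring

/-- The dual Jacobi–Trudi determinant with column lengths `c`. -/
def dualJacobiTrudi {n : ℕ} (m : ℕ) (c : Fin n → ℤ) : ℤ :=
  Matrix.det (Matrix.of fun i j : Fin n => Cz m (c i - i + j))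

lemma dualJacobiTrudi_succ {n : ℕ} (m : ℕ) (c : Fin n → ℤ) :
    dualJacobiTrudi (m + 1) c =
      ∑ s : Finset (Fin n), dualJacobiTrudi m fun j => c j - if j ∈ s then 1 else 0 := by
  have h : (Matrix.of fun i j : Fin n => Cz (m + 1) (c i - i + j)) =
      (fun i j : Fin n => Cz m (c i - 1 - i + j)) + fun i j : Fin n => Cz m (c i - i + j) := by
    ext i j
    simp only [Matrix.of_apply, Pi.add_apply]
    rw [Cz_succ, add_comm]
    congr 2
    ring
  have key := (Matrix.detRowAlternating (n := Fin n) (R := ℤ)).toMultilinearMap.map_add_univ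
    (fun i j : Fin n => Cz m (c i - 1 - i + j)) (fun i j : Fin n => Cz m (c i - i + j))
  rw [dualJacobiTrudi, h]
  refine key.trans (sum_congr rfl fun s _ => ?_)
  rw [dualJacobiTrudi]
  change Matrix.det _ = _
  congr 1
  ext i j
  by_cases hi : i ∈ s <;> simp [hi]

lemma dualJacobiTrudi_eq_zero_of_last_neg {n : ℕ} (m : ℕ) {c : Fin (n + 1) → ℤ}
    (h : c (Fin.last n) < 0) : dualJacobiTrudi m c = 0 := by
  refine Matrix.det_eq_zero_of_row_eq_zero (Fin.last n) fun j => Cz_neg _ ?_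
  have := Fin.le_last j
  rw [Fin.le_def] at this
  omega

lemma dualJacobiTrudi_eq_zero_of_succ {n : ℕ} (m : ℕ) {c : Fin (n + 1) → ℤ} (i : Fin n)
    (h : c i.succ = c i.castSucc + 1) : dualJacobiTrudi m c = 0 := by
  refine Matrix.det_zero_of_row_eq (i := i.castSucc) (j := i.succ) (Fin.castSucc_lt_succ).ne ?_
  funext j
  simp only [Matrix.of_apply, h, Fin.val_succ, Fin.val_castSucc]
  congr 1
  push_cast
  ring

/-- The dual Jacobi–Trudi formula, specialized at `m` variables equal to `1`. -/
lemma semistandardCount_eq_dualJacobiTrudi {n : ℕ} (m : ℕ) {c : Fin (n + 1) → ℕ}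
    (hc : Antitone c) :
    (semistandardCount m (columnDiagram c) : ℤ) = dualJacobiTrudi m fun j => (c j : ℤ) := by
  classical
  induction m generalizing c with
  | zero =>
    by_cases h0 : c 0 = 0
    · have hc0 : ∀ j, c j = 0 := fun j => Nat.le_zero.1 (h0 ▸ hc (Fin.zero_le j))
      have hempty : ∀ x, x ∉ columnDiagram c := by
        intro x hx
        obtain ⟨j, -, h⟩ := mem_columnDiagram.1 hx
        simp [hc0] at h
      have : IsEmpty {x // x ∈ columnDiagram c} := ⟨fun x => hempty _ x.2⟩
      have h1 : semistandardCount 0 (columnDiagram c) = 1 := by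
        rw [semistandardCount, filter_true_of_mem, card_univ, Fintype.card_unique]
        exact fun T _ => ⟨fun x => (hempty _ x.2).elim, fun x => (hempty _ x.2).elim⟩
      have h2 : (Matrix.of fun i j : Fin (n + 1) => Cz 0 ((c i : ℤ) - i + j)) = 1 := by
        ext i j
        rw [Matrix.of_apply, hc0, Matrix.one_apply]
        rcases lt_trichotomy i j with h | rfl | h
        · rw [if_neg h.ne, show ((0 : ℕ) : ℤ) - i + j = ((j - i : ℕ) : ℤ) by
            rw [Fin.lt_def] at h; omega, Cz_natCast, Nat.choose_eq_zero_of_lt]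
          · rfl
          · rw [Fin.lt_def] at h; omega
        · simp [Cz]
        · rw [if_neg h.ne', Cz_neg]
          rw [Fin.lt_def] at h
          omega
      rw [dualJacobiTrudi, h1, h2, Matrix.det_one, Nat.cast_one]
    · have hmem : (0, ((0 : Fin (n + 1)) : ℕ)) ∈ columnDiagram c :=
        mk_mem_columnDiagram.2 (Nat.pos_of_ne_zero h0)
      have h1 : semistandardCount 0 (columnDiagram c) = 0 := by
        rw [semistandardCount, card_eq_zero, filter_eq_empty_iff]
        exact fun T _ => (T ⟨_, hmem⟩).elim0
      rw [h1, dualJacobiTrudi, Matrix.det_eq_zero_of_row_eq_zero 0, Nat.cast_zero]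
      intro j
      rw [Matrix.of_apply, show ((c 0 : ℕ) : ℤ) - ((0 : Fin (n + 1)) : ℕ) + j
        = ((c 0 + j : ℕ) : ℤ) by simp, Cz_natCast, Nat.choose_eq_zero_of_lt (by omega),
        Nat.cast_zero]
  | succ m ih =>
    rw [semistandardCount_succ hc, dualJacobiTrudi_succ, Nat.cast_sum]
    refine sum_congr rfl fun s _ => ?_
    split_ifs with h
    · rw [ih h.2]
      congr 1
      funext j
      by_cases hj : j ∈ s
      · simp [shorten, hj, Nat.cast_sub (h.1 j hj : 1 ≤ c j)]
      · simp [shorten, hj]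
    · rw [Nat.cast_zero]
      by_cases hlast : Fin.last n ∈ s ∧ c (Fin.last n) = 0
      · exact (dualJacobiTrudi_eq_zero_of_last_neg m (by simp [hlast])).symm
      · have hex : ∃ i : Fin n, (c i.succ : ℤ) - (if i.succ ∈ s then 1 else 0) =
            (c i.castSucc : ℤ) - (if i.castSucc ∈ s then 1 else 0) + 1 := by
          by_contra! hne
          have hstep : ∀ i : Fin n, (c i.succ : ℤ) - (if i.succ ∈ s then 1 else 0) ≤
              (c i.castSucc : ℤ) - (if i.castSucc ∈ s then 1 else 0) := by
            intro i
            have h1 := hne i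
            have h2 := hc (Fin.castSucc_lt_succ (i := i)).le
            split_ifs at h1 ⊢ <;> omega
          have hanti : Antitone fun j => (c j : ℤ) - if j ∈ s then 1 else 0 :=
            Fin.antitone_iff_succ_le.2 hstep
          have hnonneg : ∀ j, 0 ≤ (c j : ℤ) - if j ∈ s then 1 else 0 := by
            intro j
            refine le_trans ?_ (hanti (Fin.le_last j))
            dsimp only
            split_ifs with hl
            · have := not_and.1 hlast hl
              omega
            · omega
          refine h ⟨fun j hj => ?_, fun j k hjk => ?_⟩
          · have := hnonneg j
            rw [if_pos hj] at this
            omega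
          · have h1 := hanti hjk
            have h2 := hnonneg j
            have h3 := hnonneg k
            simp only [shorten] at h1 ⊢
            split_ifs at h1 h2 h3 ⊢ <;> omega
        obtain ⟨i, hi⟩ := hex
        exact (dualJacobiTrudi_eq_zero_of_succ m i hi).symm

/-- A sum of maximal minors against an alternating weight `w` unfolds to a sum over all tuples. -/
lemma sum_strictMono_mul_det {R : Type*} [CommRing R] {n : ℕ} (S : Finset ℕ)
    (u : Fin n → ℕ → R) (w : (Fin n → ℕ) → R)
    (hw : ∀ ℓ (σ : Equiv.Perm (Fin n)), w (ℓ ∘ σ) = (Equiv.Perm.sign σ : ℤ) * w ℓ)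
    (hw' : ∀ ℓ, ¬ Function.Injective ℓ → w ℓ = 0) :
    ∑ ℓ ∈ Fintype.piFinset (fun _ : Fin n => S) with StrictMono ℓ,
        w ℓ * Matrix.det (Matrix.of fun j i => u i (ℓ j)) =
      ∑ ℓ ∈ Fintype.piFinset (fun _ : Fin n => S), w ℓ * ∏ i, u i (ℓ i) := by
  classical
  have hinj : ∑ ℓ ∈ Fintype.piFinset (fun _ : Fin n => S) with Function.Injective ℓ,
      w ℓ * ∏ i, u i (ℓ i) = ∑ ℓ ∈ Fintype.piFinset (fun _ : Fin n => S), w ℓ * ∏ i, u i (ℓ i) :=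
    sum_filter_of_ne fun ℓ _ h => by_contra fun h' => h (by rw [hw' ℓ h', zero_mul])
  rw [← hinj]
  simp only [Matrix.det_apply', mul_sum]
  rw [← sum_product']
  refine sum_bij (fun p _ => p.1 ∘ p.2) ?_ ?_ ?_ ?_
  · rintro ⟨ℓ, σ⟩ h
    simp only [mem_product, mem_filter, Fintype.mem_piFinset, mem_univ, and_true] at h ⊢
    exact ⟨fun i => h.1 _, h.2.injective.comp σ.injective⟩
  · rintro ⟨ℓ, σ⟩ h ⟨ℓ', σ'⟩ h' heq
    simp only [mem_product, mem_filter, Fintype.mem_piFinset, mem_univ, and_true] at h h' heq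
    obtain rfl : ℓ = ℓ' := by
      refine (StrictMono.range_inj h.2 h'.2).1 ?_
      rw [← σ.surjective.range_comp ℓ, ← σ'.surjective.range_comp ℓ', heq]
    simp only [Prod.mk.injEq, true_and]
    ext i
    exact congrArg _ (h.2.injective (congrFun heq i))
  · intro ℓ h
    simp only [mem_filter, Fintype.mem_piFinset] at h
    refine ⟨(ℓ ∘ Tuple.sort ℓ, (Tuple.sort ℓ)⁻¹), ?_, ?_⟩
    · simp only [mem_product, mem_filter, Fintype.mem_piFinset, mem_univ, and_true]
      exact ⟨fun i => h.1 _, (Tuple.monotone_sort ℓ).strictMono_of_injective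
        (h.2.comp (Tuple.sort ℓ).injective)⟩
    · funext i
      simp
  · rintro ⟨ℓ, σ⟩ h
    simp only [hw, Matrix.of_apply, Function.comp_apply]
    ring

/-- The antisymmetric form `sgn (b - a)` restricted to pairs of opposite parity. -/
def paritySign (a b : ℕ) : ℤ := if Even (a + b) then 0 else if a < b then 1 else -1

lemma paritySign_swap (a b : ℕ) : paritySign a b = -paritySign b a := by
  unfold paritySign
  rw [add_comm b a]
  split_ifs with h
  · rfl
  · omega
  · rfl
  · rfl
  · obtain rfl : a = b := by omega
    exact absurd ⟨a, rfl⟩ h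

lemma paritySign_add_right (a b i : ℕ) : paritySign (a + i) (b + i) = paritySign a b := by
  simp only [paritySign, add_lt_add_iff_right, Nat.even_iff]
  congr 2
  omega

/-- The Pfaffian of the `4 × 4` matrix `paritySign (ℓ i) (ℓ j)`. -/
def parityPfaffian (ℓ : Fin 4 → ℕ) : ℤ :=
  paritySign (ℓ 0) (ℓ 1) * paritySign (ℓ 2) (ℓ 3) -
    paritySign (ℓ 0) (ℓ 2) * paritySign (ℓ 1) (ℓ 3) +
    paritySign (ℓ 0) (ℓ 3) * paritySign (ℓ 1) (ℓ 2)

lemma parityPfaffian_comp_swap (ℓ : Fin 4 → ℕ) (i : Fin 3) :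
    parityPfaffian (ℓ ∘ Equiv.swap i.castSucc i.succ) = -parityPfaffian ℓ := by
  fin_cases i
  · have h0 : Equiv.swap (0 : Fin 4) 1 0 = 1 := by decide
    have h1 : Equiv.swap (0 : Fin 4) 1 1 = 0 := by decide
    have h2 : Equiv.swap (0 : Fin 4) 1 2 = 2 := by decide
    have h3 : Equiv.swap (0 : Fin 4) 1 3 = 3 := by decide
    change parityPfaffian (ℓ ∘ Equiv.swap (0 : Fin 4) 1) = _
    simp only [parityPfaffian, Function.comp_apply, h0, h1, h2, h3]
    rw [paritySign_swap (ℓ 1) (ℓ 0)]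
    ring
  · have h0 : Equiv.swap (1 : Fin 4) 2 0 = 0 := by decide
    have h1 : Equiv.swap (1 : Fin 4) 2 1 = 2 := by decide
    have h2 : Equiv.swap (1 : Fin 4) 2 2 = 1 := by decide
    have h3 : Equiv.swap (1 : Fin 4) 2 3 = 3 := by decide
    change parityPfaffian (ℓ ∘ Equiv.swap (1 : Fin 4) 2) = _
    simp only [parityPfaffian, Function.comp_apply, h0, h1, h2, h3]
    rw [paritySign_swap (ℓ 2) (ℓ 1)]
    ring
  · have h0 : Equiv.swap (2 : Fin 4) 3 0 = 0 := by decide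
    have h1 : Equiv.swap (2 : Fin 4) 3 1 = 1 := by decide
    have h2 : Equiv.swap (2 : Fin 4) 3 2 = 3 := by decide
    have h3 : Equiv.swap (2 : Fin 4) 3 3 = 2 := by decide
    change parityPfaffian (ℓ ∘ Equiv.swap (2 : Fin 4) 3) = _
    simp only [parityPfaffian, Function.comp_apply, h0, h1, h2, h3]
    rw [paritySign_swap (ℓ 3) (ℓ 2)]
    ring

lemma parityPfaffian_comp_perm (ℓ : Fin 4 → ℕ) (σ : Equiv.Perm (Fin 4)) :
    parityPfaffian (ℓ ∘ σ) = Equiv.Perm.sign σ * parityPfaffian ℓ := by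
  have hσ : σ ∈ Submonoid.closure
      (Set.range fun i : Fin 3 => Equiv.swap i.castSucc i.succ) := by
    rw [Equiv.Perm.mclosure_swap_castSucc_succ]
    trivial
  induction hσ using Submonoid.closure_induction_right with
  | one => simp
  | mul_right σ _ τ hτ ih =>
    obtain ⟨i, rfl⟩ := hτ
    rw [Equiv.Perm.coe_mul, ← Function.comp_assoc, parityPfaffian_comp_swap, ih, map_mul,
      Equiv.Perm.sign_swap (Fin.castSucc_lt_succ).ne]
    simp

lemma parityPfaffian_of_not_injective {ℓ : Fin 4 → ℕ} (h : ¬ Function.Injective ℓ) :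
    parityPfaffian ℓ = 0 := by
  obtain ⟨i, j, hij, hne⟩ := Function.not_injective_iff.1 h
  have hswap : ℓ ∘ Equiv.swap i j = ℓ := by
    funext k
    rcases eq_or_ne k i with rfl | hi
    · simp [hij]
    · rcases eq_or_ne k j with rfl | hj
      · simp [hij]
      · simp [Equiv.swap_apply_of_ne_of_ne hi hj]
  have := parityPfaffian_comp_perm ℓ (Equiv.swap i j)
  rw [hswap, Equiv.Perm.sign_swap hne] at this
  simp only [Units.val_neg, Units.val_one] at this
  linarith

/-- Consecutive entries have opposite parity. -/
def IsAlternating (ℓ : Fin 4 → ℕ) : Prop :=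
  Odd (ℓ 0 + ℓ 1) ∧ Odd (ℓ 1 + ℓ 2) ∧ Odd (ℓ 2 + ℓ 3)

instance : DecidablePred IsAlternating := fun _ => by unfold IsAlternating; infer_instance

lemma parityPfaffian_of_strictMono {ℓ : Fin 4 → ℕ} (h : StrictMono ℓ) :
    parityPfaffian ℓ = if IsAlternating ℓ then 2 else 0 := by
  have h01 : ℓ 0 < ℓ 1 := h (by decide)
  have h12 : ℓ 1 < ℓ 2 := h (by decide)
  have h23 : ℓ 2 < ℓ 3 := h (by decide)
  simp only [parityPfaffian, paritySign, IsAlternating, h01, h12, h23, h01.trans h12,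
    h12.trans h23, (h01.trans h12).trans h23, if_true, Nat.even_add,
    ← Nat.not_even_iff_odd]
  by_cases e0 : Even (ℓ 0) <;> by_cases e1 : Even (ℓ 1) <;> by_cases e2 : Even (ℓ 2) <;>
    by_cases e3 : Even (ℓ 3) <;> simp [e0, e1, e2, e3]

lemma sum_piFinset_fin_four {R : Type*} [AddCommMonoid R] (S : Finset ℕ)
    (g : ℕ → ℕ → ℕ → ℕ → R) :
    ∑ ℓ ∈ Fintype.piFinset (fun _ : Fin 4 => S), g (ℓ 0) (ℓ 1) (ℓ 2) (ℓ 3) =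
      ∑ a ∈ S, ∑ b ∈ S, ∑ c ∈ S, ∑ d ∈ S, g a b c d := by
  simp only [← sum_product']
  refine sum_nbij' (fun ℓ => (ℓ 0, ℓ 1, ℓ 2, ℓ 3)) (fun p => ![p.1, p.2.1, p.2.2.1, p.2.2.2])
    ?_ ?_ ?_ ?_ ?_
  · intro ℓ h
    simp_all [Fintype.mem_piFinset]
  · rintro ⟨a, b, c, d⟩ h
    simp_all [Fintype.mem_piFinset, Fin.forall_fin_succ]
  · intro ℓ _
    funext i
    fin_cases i <;> rfl
  · exact fun _ _ => rfl
  · exact fun _ _ => rfl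

/-- The bilinear form `paritySign` evaluated at two weight sequences. -/
noncomputable def parityForm {R : Type*} [CommRing R] (S : Finset ℕ) (u v : ℕ → R) : R :=
  ∑ a ∈ S, ∑ b ∈ S, (paritySign a b : R) * (u a * v b)

lemma sum_parityPfaffian_mul_prod {R : Type*} [CommRing R] (S : Finset ℕ) (u : Fin 4 → ℕ → R) :
    ∑ ℓ ∈ Fintype.piFinset (fun _ : Fin 4 => S), (parityPfaffian ℓ : R) * ∏ i, u i (ℓ i) =
      parityForm S (u 0) (u 1) * parityForm S (u 2) (u 3) -
        parityForm S (u 0) (u 2) * parityForm S (u 1) (u 3) +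
        parityForm S (u 0) (u 3) * parityForm S (u 1) (u 2) := by
  have h1 : parityForm S (u 0) (u 1) * parityForm S (u 2) (u 3) =
      ∑ ℓ ∈ Fintype.piFinset (fun _ : Fin 4 => S),
        ((paritySign (ℓ 0) (ℓ 1) : R) * (u 0 (ℓ 0) * u 1 (ℓ 1))) *
          ((paritySign (ℓ 2) (ℓ 3) : R) * (u 2 (ℓ 2) * u 3 (ℓ 3))) := by
    rw [sum_piFinset_fin_four S fun a b c d => ((paritySign a b : R) * (u 0 a * u 1 b)) *
          ((paritySign c d : R) * (u 2 c * u 3 d))]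
    simp only [parityForm, sum_mul_sum]
    refine sum_congr rfl fun a _ => ?_
    rw [sum_comm]
  have h2 : parityForm S (u 0) (u 2) * parityForm S (u 1) (u 3) =
      ∑ ℓ ∈ Fintype.piFinset (fun _ : Fin 4 => S),
        ((paritySign (ℓ 0) (ℓ 2) : R) * (u 0 (ℓ 0) * u 2 (ℓ 2))) *
          ((paritySign (ℓ 1) (ℓ 3) : R) * (u 1 (ℓ 1) * u 3 (ℓ 3))) := by
    rw [sum_piFinset_fin_four S fun a b c d => ((paritySign a c : R) * (u 0 a * u 2 c)) *
          ((paritySign b d : R) * (u 1 b * u 3 d))]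
    simp only [parityForm, sum_mul_sum]
  have h3 : parityForm S (u 0) (u 3) * parityForm S (u 1) (u 2) =
      ∑ ℓ ∈ Fintype.piFinset (fun _ : Fin 4 => S),
        ((paritySign (ℓ 0) (ℓ 3) : R) * (u 0 (ℓ 0) * u 3 (ℓ 3))) *
          ((paritySign (ℓ 1) (ℓ 2) : R) * (u 1 (ℓ 1) * u 2 (ℓ 2))) := by
    rw [sum_piFinset_fin_four S fun a b c d => ((paritySign a d : R) * (u 0 a * u 3 d)) *
          ((paritySign b c : R) * (u 1 b * u 2 c))]
    simp only [parityForm, sum_mul_sum]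
    refine sum_congr rfl fun a _ => sum_congr rfl fun b _ => ?_
    rw [sum_comm]
  rw [h1, h2, h3, ← sum_sub_distrib, ← sum_add_distrib]
  refine sum_congr rfl fun ℓ _ => ?_
  rw [Fin.prod_univ_four, parityPfaffian]
  push_cast
  ring

lemma Cz_of_lt {m : ℕ} {k : ℕ} (h : m < k) : Cz m k = 0 := by
  rw [Cz_natCast, Nat.choose_eq_zero_of_lt h, Nat.cast_zero]

lemma sum_range_Cz_sub {R : Type*} [CommRing R] (m i N : ℕ) (hN : m + 1 + i ≤ N) (f : ℕ → R) :
    ∑ k ∈ range N, f k * (Cz m ((k : ℤ) - i) : R) =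
      ∑ a ∈ range (m + 1), f (a + i) * (Cz m a : R) := by
  obtain ⟨t, rfl⟩ := Nat.exists_eq_add_of_le hN
  rw [show m + 1 + i + t = i + (m + 1) + t by ring, sum_range_add, sum_range_add,
    sum_eq_zero, zero_add, add_eq_left.2]
  · refine sum_congr rfl fun a _ => ?_
    rw [add_comm i a]
    push_cast
    rw [add_sub_cancel_right]
  · refine sum_eq_zero fun k _ => ?_
    rw [show ((i + (m + 1) + k : ℕ) : ℤ) - i = (m + 1 + k : ℕ) by push_cast; ring,
      Cz_of_lt (by omega), Int.cast_zero, mul_zero]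
  · intro k hk
    rw [Cz_neg _ (by have := mem_range.1 hk; omega), Int.cast_zero, mul_zero]

/-- The sequence `C(m, k - i)`, weighted by `X ^ k`. -/
noncomputable def chooseWeight (m i k : ℕ) : ℤ[X] := (Cz m ((k : ℤ) - i) : ℤ[X]) * X ^ k

lemma two_mul_parityForm_chooseWeight (m i d N : ℕ) (hN : m + 1 + (i + d) ≤ N) :
    2 * parityForm (range N) (chooseWeight m i) (chooseWeight m (i + d)) =
      X ^ (2 * i + d) * ∑ a ∈ range (m + 1), ∑ b ∈ range (m + 1),
        ((paritySign a (b + d) + paritySign b (a + d) : ℤ) : ℤ[X]) *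
          ((Cz m a : ℤ[X]) * (Cz m b : ℤ[X]) * X ^ (a + b)) := by
  have h1 : parityForm (range N) (chooseWeight m i) (chooseWeight m (i + d)) =
      X ^ (2 * i + d) * ∑ a ∈ range (m + 1), ∑ b ∈ range (m + 1),
        (paritySign a (b + d) : ℤ[X]) *
          ((Cz m a : ℤ[X]) * (Cz m b : ℤ[X]) * X ^ (a + b)) := by
    calc
      _ = ∑ a ∈ range N, (∑ b ∈ range N, (paritySign a b : ℤ[X]) * X ^ (a + b) *
            (Cz m ((b : ℤ) - (i + d : ℕ)) : ℤ[X])) * (Cz m ((a : ℤ) - i) : ℤ[X]) := by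
        simp only [parityForm, sum_mul, chooseWeight]
        refine sum_congr rfl fun a _ => sum_congr rfl fun b _ => ?_
        ring
      _ = _ := by
        rw [sum_range_Cz_sub m i N (by omega), mul_sum]
        refine sum_congr rfl fun a _ => ?_
        rw [sum_range_Cz_sub m (i + d) N hN, sum_mul, mul_sum]
        refine sum_congr rfl fun b _ => ?_
        rw [show b + (i + d) = b + d + i by ring, paritySign_add_right]
        ring
  have h2 := h1
  rw [sum_comm] at h2
  rw [two_mul]
  nth_rewrite 1 [h1]
  rw [h2, ← mul_add, ← sum_add_distrib]
  congr 1
  refine sum_congr rfl fun a _ => ?_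
  rw [← sum_add_distrib]
  refine sum_congr rfl fun b _ => ?_
  push_cast
  ring

/-- The generating polynomial of `C(m, a) C(m, a + d)`. -/
noncomputable def chooseMulPoly (m d : ℕ) : ℤ[X] :=
  ∑ a ∈ range (m + 1), ((Cz m a * Cz m (a + d : ℕ) : ℤ) : ℤ[X]) * X ^ a

lemma coeff_chooseMulPoly (m d k : ℕ) :
    (chooseMulPoly m d).coeff k = Cz m k * Cz m (k + d : ℕ) := by
  simp only [chooseMulPoly, finsetSum_coeff, ← C_eq_intCast, coeff_C_mul, coeff_X_pow,
    mul_ite, mul_one, mul_zero, sum_ite_eq, Int.cast_id]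
  rw [ite_eq_left_iff]
  intro h
  rw [Cz_of_lt (by simpa using h), zero_mul]

lemma X_pow_mul_expand_chooseMulPoly (m d : ℕ) :
    X ^ d * expand ℤ 2 (chooseMulPoly m d) = ∑ a ∈ range (m + 1), ∑ b ∈ range (m + 1),
      if b = a + d then (Cz m a : ℤ[X]) * (Cz m b : ℤ[X]) * X ^ (a + b) else 0 := by
  rw [chooseMulPoly, map_sum, mul_sum]
  refine sum_congr rfl fun a _ => ?_
  rw [sum_ite_eq']
  split_ifs with h
  · simp only [map_mul, map_intCast, map_pow, expand_X]
    push_cast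
    ring
  · rw [Cz_of_lt (k := a + d) (by simpa using h)]
    simp

lemma X_pow_mul_expand_chooseMulPoly' (m d : ℕ) :
    X ^ d * expand ℤ 2 (chooseMulPoly m d) = ∑ a ∈ range (m + 1), ∑ b ∈ range (m + 1),
      if a = b + d then (Cz m a : ℤ[X]) * (Cz m b : ℤ[X]) * X ^ (a + b) else 0 := by
  rw [X_pow_mul_expand_chooseMulPoly, sum_comm]
  refine sum_congr rfl fun a _ => sum_congr rfl fun b _ => ?_
  rw [mul_comm (Cz m b : ℤ[X]), add_comm b a]

lemma parityForm_chooseWeight_one (m i N : ℕ) (hN : m + 1 + (i + 1) ≤ N) :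
    parityForm (range N) (chooseWeight m i) (chooseWeight m (i + 1)) =
      X ^ (2 * i + 1) * expand ℤ 2 (chooseMulPoly m 0) := by
  refine mul_left_cancel₀ (two_ne_zero' ℤ[X]) ?_
  have h0 := X_pow_mul_expand_chooseMulPoly m 0
  rw [pow_zero, one_mul] at h0
  rw [two_mul_parityForm_chooseWeight m i 1 N hN, h0, mul_left_comm]
  congr 1
  simp only [mul_sum]
  refine sum_congr rfl fun a _ => sum_congr rfl fun b _ => ?_
  have : paritySign a (b + 1) + paritySign b (a + 1) = if b = a + 0 then 2 else 0 := by
    simp only [paritySign, Nat.even_iff]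
    split_ifs <;> omega
  rw [this]
  split_ifs <;> simp

lemma parityForm_chooseWeight_two (m i N : ℕ) (hN : m + 1 + (i + 2) ≤ N) :
    parityForm (range N) (chooseWeight m i) (chooseWeight m (i + 2)) =
      X ^ (2 * i + 2) * (2 * (X * expand ℤ 2 (chooseMulPoly m 1))) := by
  refine mul_left_cancel₀ (two_ne_zero' ℤ[X]) ?_
  have h1 := X_pow_mul_expand_chooseMulPoly m 1
  have h1' := X_pow_mul_expand_chooseMulPoly' m 1
  rw [pow_one] at h1 h1'
  rw [two_mul_parityForm_chooseWeight m i 2 N hN, two_mul (X * _)]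
  nth_rewrite 1 [h1]
  rw [h1', mul_left_comm]
  congr 1
  simp only [mul_sum, ← sum_add_distrib]
  refine sum_congr rfl fun a _ => sum_congr rfl fun b _ => ?_
  have : paritySign a (b + 2) + paritySign b (a + 2) =
      (if b = a + 1 then 2 else 0) + if a = b + 1 then 2 else 0 := by
    simp only [paritySign, Nat.even_iff]
    split_ifs <;> omega
  rw [this]
  split_ifs <;> push_cast <;> ring

lemma parityForm_chooseWeight_three (m i N : ℕ) (hN : m + 1 + (i + 3) ≤ N) :
    parityForm (range N) (chooseWeight m i) (chooseWeight m (i + 3)) =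
      X ^ (2 * i + 3) *
        (expand ℤ 2 (chooseMulPoly m 0) + 2 * (X ^ 2 * expand ℤ 2 (chooseMulPoly m 2))) := by
  refine mul_left_cancel₀ (two_ne_zero' ℤ[X]) ?_
  have h0 := X_pow_mul_expand_chooseMulPoly m 0
  have h1 := X_pow_mul_expand_chooseMulPoly m 2
  have h1' := X_pow_mul_expand_chooseMulPoly' m 2
  rw [pow_zero, one_mul] at h0
  rw [two_mul_parityForm_chooseWeight m i 3 N hN, two_mul (X ^ 2 * _)]
  nth_rewrite 1 [h1]
  rw [h1', h0, mul_left_comm]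
  congr 1
  simp only [← sum_add_distrib]
  simp only [mul_sum]
  refine sum_congr rfl fun a _ => sum_congr rfl fun b _ => ?_
  have : paritySign a (b + 3) + paritySign b (a + 3) =
      (if b = a + 0 then 2 else 0) +
        ((if b = a + 2 then 2 else 0) + if a = b + 2 then 2 else 0) := by
    simp only [paritySign, Nat.even_iff]
    split_ifs <;> omega
  rw [this]
  split_ifs <;> push_cast <;> ring

/-- The generating polynomial of the left-hand sides. -/
noncomputable def chooseSumPoly (m : ℕ) : ℤ[X] :=
  chooseMulPoly m 0 ^ 2 + X * (chooseMulPoly m 2 * chooseMulPoly m 0) -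
    2 * (X * (chooseMulPoly m 1 * chooseMulPoly m 1))

lemma det_chooseWeight (m : ℕ) (ℓ : Fin 4 → ℕ) :
    Matrix.det (Matrix.of fun j i : Fin 4 => chooseWeight m i (ℓ j)) =
      C (Matrix.det (Matrix.of fun j i : Fin 4 => Cz m ((ℓ j : ℤ) - i))) * X ^ ∑ i, ℓ i := by
  rw [← prod_pow_eq_pow_sum, mul_comm, RingHom.map_det, ← Matrix.det_mul_column]
  congr 1
  ext1 j i
  simp [chooseWeight, mul_comm]

lemma sum_alternating_det (m N : ℕ) (hN : m + 4 ≤ N) :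
    ∑ ℓ ∈ Fintype.piFinset (fun _ : Fin 4 => range N) with StrictMono ℓ ∧ IsAlternating ℓ,
        C (Matrix.det (Matrix.of fun j i : Fin 4 => Cz m ((ℓ j : ℤ) - i))) * X ^ ∑ i, ℓ i =
      expand ℤ 2 (chooseSumPoly m) * X ^ 6 := by
  have key := sum_strictMono_mul_det (range N) (fun i : Fin 4 => chooseWeight m i)
    (fun ℓ => (parityPfaffian ℓ : ℤ[X]))
    (fun ℓ σ => by rw [parityPfaffian_comp_perm]; push_cast; rfl)
    (fun ℓ h => by rw [parityPfaffian_of_not_injective h, Int.cast_zero])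
  rw [sum_parityPfaffian_mul_prod] at key
  have h01 := parityForm_chooseWeight_one m 0 N (by omega)
  have h12 := parityForm_chooseWeight_one m 1 N (by omega)
  have h23 := parityForm_chooseWeight_one m 2 N (by omega)
  have h02 := parityForm_chooseWeight_two m 0 N (by omega)
  have h13 := parityForm_chooseWeight_two m 1 N (by omega)
  have h03 := parityForm_chooseWeight_three m 0 N (by omega)
  change _ = parityForm (range N) (chooseWeight m 0) (chooseWeight m (0 + 1)) *
    parityForm (range N) (chooseWeight m 2) (chooseWeight m (2 + 1)) -
    parityForm (range N) (chooseWeight m 0) (chooseWeight m (0 + 2)) *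
    parityForm (range N) (chooseWeight m 1) (chooseWeight m (1 + 2)) +
    parityForm (range N) (chooseWeight m 0) (chooseWeight m (0 + 3)) *
    parityForm (range N) (chooseWeight m 1) (chooseWeight m (1 + 1)) at key
  rw [h01, h12, h23, h02, h13, h03] at key
  refine mul_left_cancel₀ (two_ne_zero' ℤ[X]) ?_
  rw [← filter_filter, sum_filter, mul_sum]
  refine Eq.trans (sum_congr rfl fun ℓ hℓ => ?_) (key.trans ?_)
  · rw [det_chooseWeight, parityPfaffian_of_strictMono (mem_filter.1 hℓ).2]
    split_ifs <;> simp
  · simp only [chooseSumPoly, map_add, map_sub, map_mul, map_pow, expand_X, map_ofNat]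
    ring

lemma coeff_X_mul_mul (p q : ℤ[X]) (n : ℕ) :
    (X * (p * q)).coeff n = ∑ k ∈ range n, p.coeff k * q.coeff (n - 1 - k) := by
  cases n with
  | zero => simp
  | succ n =>
    rw [coeff_X_mul, coeff_mul, Nat.sum_antidiagonal_eq_sum_range_succ_mk]
    rfl

lemma coeff_chooseSumPoly (m n : ℕ) :
    (chooseSumPoly m).coeff n =
      ∑ k ∈ range (n + 2),
        (Cz m ((k : ℤ) - 1) ^ 2 * Cz m (((n + 1 : ℕ) : ℤ) - k) ^ 2 +
          Cz m ((k : ℤ) - 2) * Cz m (k : ℤ) * Cz m (((n + 1 : ℕ) : ℤ) - k) ^ 2 -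
          2 * Cz m ((k : ℤ) - 1) * Cz m (k : ℤ) * Cz m (((n + 1 : ℕ) : ℤ) - k - 1) *
            Cz m (((n + 1 : ℕ) : ℤ) - k)) := by
  rw [sum_sub_distrib, sum_add_distrib, chooseSumPoly, coeff_sub, coeff_add, coeff_ofNat_mul,
    coeff_X_mul_mul, coeff_X_mul_mul, pow_two, coeff_mul,
    Nat.sum_antidiagonal_eq_sum_range_succ_mk]
  simp only [coeff_chooseMulPoly]
  congr 2
  · rw [sum_range_succ' _ (n + 1), Cz_neg m (by simp : ((0 : ℕ) : ℤ) - 1 < 0)]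
    simp only [ne_eq, OfNat.ofNat_ne_zero, not_false_eq_true, zero_pow, zero_mul, add_zero]
    refine sum_congr rfl fun k hk => ?_
    have hk := mem_range.1 hk
    rw [show ((k + 1 : ℕ) : ℤ) - 1 = (k : ℕ) by push_cast; ring,
      show ((n + 1 : ℕ) : ℤ) - (k + 1 : ℕ) = (n - k : ℕ) by omega]
    ring
  · rw [sum_range_succ' _ (n + 1), sum_range_succ' _ n,
      Cz_neg m (by simp : ((0 : ℕ) : ℤ) - 2 < 0),
      Cz_neg m (by simp : ((0 + 1 : ℕ) : ℤ) - 2 < 0)]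
    simp only [zero_mul, add_zero]
    refine sum_congr rfl fun k hk => ?_
    have hk := mem_range.1 hk
    rw [show ((k + 1 + 1 : ℕ) : ℤ) - 2 = (k : ℕ) by push_cast; ring,
      show ((n + 1 : ℕ) : ℤ) - (k + 1 + 1 : ℕ) = (n - 1 - k : ℕ) by omega]
    ring
  · rw [mul_sum, sum_range_succ' _ (n + 1), sum_range_succ _ n,
      Cz_neg m (by simp : ((0 : ℕ) : ℤ) - 1 < 0),
      Cz_neg m (by simp : ((n + 1 : ℕ) : ℤ) - (n + 1 : ℕ) - 1 < 0)]
    simp only [zero_mul, mul_zero, add_zero]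
    refine sum_congr rfl fun k hk => ?_
    have hk := mem_range.1 hk
    rw [show ((k + 1 : ℕ) : ℤ) - 1 = (k : ℕ) by push_cast; ring,
      show ((n + 1 : ℕ) : ℤ) - (k + 1 : ℕ) - 1 = (n - 1 - k : ℕ) by omega,
      show ((n + 1 : ℕ) : ℤ) - (k + 1 : ℕ) = (n - 1 - k + 1 : ℕ) by omega]
    ring

/-- The determinant in terms of the reversed, shifted (increasing) column lengths. -/
lemma dualJacobiTrudi_eq_det_rev {n : ℕ} (m : ℕ) (c : Fin n → ℤ) :
    dualJacobiTrudi m c =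
      Matrix.det (Matrix.of fun j i : Fin n => Cz m (c j.rev + j - i)) := by
  rw [dualJacobiTrudi, ← Matrix.det_submatrix_equiv_self Fin.revPerm]
  congr 1
  ext j i
  simp only [Matrix.submatrix_apply, Matrix.of_apply, Fin.revPerm_apply, Fin.val_rev]
  congr 1
  omega

/-- The column lengths of `(4^{i4}, 3^{2 i3}, 2^{2 i2}, 1^{2 i1})`. -/
def columnLengths (i4 i3 i2 i1 : ℕ) : Fin 4 → ℕ :=
  ![i4 + 2 * i3 + 2 * i2 + 2 * i1, i4 + 2 * i3 + 2 * i2, i4 + 2 * i3, i4]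

lemma antitone_columnLengths (i4 i3 i2 i1 : ℕ) : Antitone (columnLengths i4 i3 i2 i1) := by
  rw [Fin.antitone_iff_succ_le]
  intro i
  fin_cases i <;> simp [columnLengths]

lemma cellsOf_rl (i4 i3 i2 i1 : ℕ) :
    cellsOf (rl i4 i3 i2 i1) (i4 + 2 * i3 + 2 * i2 + 2 * i1) 4 =
      columnDiagram (columnLengths i4 i3 i2 i1) := by
  ext ⟨a, b⟩
  rw [mem_columnDiagram, cellsOf, mem_filter, mem_product, mem_range, mem_range]
  simp only [rl]
  constructor
  · rintro ⟨⟨h1, h2⟩, h3⟩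
    refine ⟨⟨b, h2⟩, rfl, ?_⟩
    interval_cases b <;> simp only [columnLengths] <;> split_ifs at h3 <;> simp <;> omega
  · rintro ⟨j, rfl, h⟩
    fin_cases j <;> simp [columnLengths] at h ⊢ <;> split_ifs <;> omega

/-- The strictly increasing sequence attached to `(4^{i4}, 3^{2 i3}, 2^{2 i2}, 1^{2 i1})`. -/
def shiftedColumnLengths (i4 i3 i2 i1 : ℕ) : Fin 4 → ℕ :=
  ![i4, i4 + 2 * i3 + 1, i4 + 2 * i3 + 2 * i2 + 2, i4 + 2 * i3 + 2 * i2 + 2 * i1 + 3]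

lemma numSSYT_rl (m i4 i3 i2 i1 : ℕ) :
    (numSSYT m (rl i4 i3 i2 i1) (i4 + 2 * i3 + 2 * i2 + 2 * i1) 4 : ℤ) =
      Matrix.det (Matrix.of fun j i : Fin 4 =>
        Cz m ((shiftedColumnLengths i4 i3 i2 i1 j : ℤ) - i)) := by
  rw [numSSYT_eq_semistandardCount, cellsOf_rl,
    semistandardCount_eq_dualJacobiTrudi m (antitone_columnLengths i4 i3 i2 i1),
    dualJacobiTrudi_eq_det_rev]
  congr 1
  ext j i
  simp only [Matrix.of_apply]
  congr 2
  fin_cases j <;> rfl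

lemma sum_numSSYT_rl (m n N : ℕ) (hN : 2 * n + 7 ≤ N) :
    ∑ t ∈ (range (2 * (n + 1)) ×ˢ range (2 * (n + 1)) ×ˢ range (2 * (n + 1)) ×ˢ
          range (2 * (n + 1))).filter
        (fun t : ℕ × ℕ × ℕ × ℕ =>
          4 * t.1 + 6 * t.2.1 + 4 * t.2.2.1 + 2 * t.2.2.2 = 2 * (n + 1) - 2),
        (numSSYT m (rl t.1 t.2.1 t.2.2.1 t.2.2.2)
          (t.1 + 2 * t.2.1 + 2 * t.2.2.1 + 2 * t.2.2.2) 4 : ℤ) =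
      ∑ ℓ ∈ Fintype.piFinset (fun _ : Fin 4 => range N) with StrictMono ℓ ∧ IsAlternating ℓ,
        if ∑ i, ℓ i = 2 * n + 6 then
          Matrix.det (Matrix.of fun j i : Fin 4 => Cz m ((ℓ j : ℤ) - i)) else 0 := by
  rw [← sum_filter, filter_filter]
  refine sum_nbij' (fun t => shiftedColumnLengths t.1 t.2.1 t.2.2.1 t.2.2.2)
    (fun ℓ => (ℓ 0, (ℓ 1 - ℓ 0 - 1) / 2, (ℓ 2 - ℓ 1 - 1) / 2, (ℓ 3 - ℓ 2 - 1) / 2))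
    ?_ ?_ ?_ ?_ ?_
  · rintro ⟨a, b, c, d⟩ h
    simp only [mem_filter, mem_product, mem_range] at h
    simp only [mem_filter, Fintype.mem_piFinset, mem_range, Fin.strictMono_iff_lt_succ,
      Fin.forall_fin_succ, Fin.sum_univ_four, IsAlternating, shiftedColumnLengths, Nat.odd_iff]
    simp
    omega
  · intro ℓ h
    simp only [mem_filter, Fintype.mem_piFinset, mem_range, Fin.sum_univ_four, IsAlternating,
      Nat.odd_iff] at h
    obtain ⟨-, ⟨h1, h2⟩, h3⟩ := h
    have h01 : ℓ 0 < ℓ 1 := h1 (by decide)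
    have h12 : ℓ 1 < ℓ 2 := h1 (by decide)
    have h23 : ℓ 2 < ℓ 3 := h1 (by decide)
    simp only [mem_filter, mem_product, mem_range]
    omega
  · rintro ⟨a, b, c, d⟩ -
    simp [shiftedColumnLengths]
    omega
  · intro ℓ h
    simp only [mem_filter, Fintype.mem_piFinset, mem_range, Fin.sum_univ_four, IsAlternating,
      Nat.odd_iff] at h
    obtain ⟨-, ⟨h1, h2⟩, h3⟩ := h
    have h01 : ℓ 0 < ℓ 1 := h1 (by decide)
    have h12 : ℓ 1 < ℓ 2 := h1 (by decide)
    have h23 : ℓ 2 < ℓ 3 := h1 (by decide)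
    funext i
    fin_cases i <;> simp [shiftedColumnLengths] <;> omega
  · rintro ⟨a, b, c, d⟩ -
    exact numSSYT_rl m a b c d

/-- For all `m ≥ 0` and `r ≥ 1`,
`∑_{k=0}^r (C(m,k-1)^2 C(m,r-k)^2 + C(m,k-2) C(m,k) C(m,r-k)^2
   - 2 C(m,k-1) C(m,k) C(m,r-k-1) C(m,r-k)) = ∑_λ N_λ(m)`,
where `λ` runs over all partitions of `2r - 2` with all parts in `{1,2,3,4}` in which
each of the parts `1`, `2`, `3` occurs an even number of times, i.e. over all
`λ = (4^{i4}, 3^{2 i3}, 2^{2 i2}, 1^{2 i1})` with `4 i4 + 6 i3 + 4 i2 + 2 i1 = 2r - 2`,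
and `N_λ(m)` is the number of semistandard Young tableaux of shape `λ` with entries
in `{1, …, m}`. -/
theorem choose_sum_eq_numSSYT_sum (m : ℕ) (r : ℕ) (hr : 1 ≤ r) :
    ∑ k ∈ Finset.range (r + 1),
        (Cz m ((k : ℤ) - 1) ^ 2 * Cz m ((r : ℤ) - k) ^ 2 +
          Cz m ((k : ℤ) - 2) * Cz m (k : ℤ) * Cz m ((r : ℤ) - k) ^ 2 -
          2 * Cz m ((k : ℤ) - 1) * Cz m (k : ℤ) * Cz m ((r : ℤ) - k - 1) * Cz m ((r : ℤ) - k)) =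
      ∑ t ∈ (Finset.range (2 * r) ×ˢ Finset.range (2 * r) ×ˢ Finset.range (2 * r) ×ˢ
              Finset.range (2 * r)).filter
          (fun t : ℕ × ℕ × ℕ × ℕ =>
            4 * t.1 + 6 * t.2.1 + 4 * t.2.2.1 + 2 * t.2.2.2 = 2 * r - 2),
        (numSSYT m (rl t.1 t.2.1 t.2.2.1 t.2.2.2)
            (t.1 + 2 * t.2.1 + 2 * t.2.2.1 + 2 * t.2.2.2) 4 : ℤ) := by
  obtain ⟨n, rfl⟩ := Nat.exists_eq_add_of_le' hr
  rw [← coeff_chooseSumPoly, sum_numSSYT_rl m n (m + 2 * n + 7) (by omega)]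
  have h := congrArg (coeff · (n * 2 + 6)) (sum_alternating_det m (m + 2 * n + 7) (by omega))
  simp only [coeff_mul_X_pow, coeff_expand_mul two_pos, finsetSum_coeff, coeff_C_mul,
    coeff_X_pow, mul_ite, mul_one, mul_zero] at h
  rw [← h]
  exact Finset.sum_congr rfl fun ℓ _ => if_congr (by omega) rfl rfl
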